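/- Let ℓ ≥ 5 be prime. The form η^{ℓ²} lies in S_{λ+1/2}(1, ν_η^{ℓ²}) with λ + 1/2 = ℓ²/2, and satisfies η^{ℓ²} ≡ Σ_{n≥1} (12/n) q^{ℓ²n²/24} (mod ℓ). (In particular, the hypothesis λ + 1/2 < ℓ²/2 in the main classification theorem is sharp: η^{ℓ²} is supported modulo ℓ on a single square class yet its reduction is not of any of the three shapes allowed there.) -/

import Mathlib

open Complex UpperHalfPlane CongruenceSubgroup Matrix NumberField
open scoped Manifold MatrixGroups Real

noncomputable section

abbrev SL2Z := Matrix.SpecialLinearGroup (Fin 2) ℤ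

/-- The automorphy denominator `c z + d` for `γ = (a b; c d)`. -/
def sldenom (γ : SL2Z) (z : ℍ) : ℂ := ((γ 1 0 : ℤ) : ℂ) * (z : ℂ) + ((γ 1 1 : ℤ) : ℂ)

/-- `q^{n/24} = e^{2π i n z/24}`. -/
def q24 (n : ℕ) (z : ℍ) : ℂ := Complex.exp (2 * Real.pi * Complex.I * (n : ℂ) * (z : ℂ) / 24)

/-- The Dedekind eta function `η(z) = q^{1/24} ∏_{n≥1} (1 - qⁿ)`. -/
def dedekindEta (z : ℍ) : ℂ :=
  Complex.exp (Real.pi * Complex.I * (z : ℂ) / 12) *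
    ∏' n : ℕ, (1 - Complex.exp (2 * Real.pi * Complex.I * ((n : ℂ) + 1) * (z : ℂ)))

/-- The Jacobi theta function `θ(z) = Σ_{n ∈ ℤ} q^{n²}`. -/
def theta (z : ℍ) : ℂ := ∑' n : ℤ, Complex.exp (2 * Real.pi * Complex.I * ((n : ℂ)) ^ 2 * (z : ℂ))

/-- The eta multiplier `ν_η`, characterized by
`η(γz) = ν_η(γ) (cz+d)^{1/2} η(z)` (principal branch); we evaluate at `z = i`. -/
def nuEta (γ : SL2Z) : ℂ :=
  dedekindEta (γ • UpperHalfPlane.I) / (sldenom γ UpperHalfPlane.I ^ ((1 : ℂ) / 2) * dedekindEta UpperHalfPlane.I)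

/-- The theta multiplier `ν_θ`, characterized by
`θ(γz) = ν_θ(γ) (cz+d)^{1/2} θ(z)` (principal branch) for `γ ∈ Γ₀(4)`. -/
def nuTheta (γ : SL2Z) : ℂ :=
  theta (γ • UpperHalfPlane.I) /
    (sldenom γ UpperHalfPlane.I ^ ((1 : ℂ) / 2) * theta UpperHalfPlane.I)

/-- The Kronecker symbol `(12/n)`. -/
def kron12 (n : ℤ) : ℤ :=
  if n % 12 = 1 ∨ n % 12 = 11 then 1 else if n % 12 = 5 ∨ n % 12 = 7 then -1 else 0

/-- Holomorphic modular forms of (possibly half-integral) weight `k`, level `Γ₀(N)` and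
multiplier system `ν`: holomorphy, transformation, and boundedness at all cusps. -/
def IsModForm (N : ℕ) (k : ℝ) (ν : SL2Z → ℂ) (f : ℍ → ℂ) : Prop :=
  MDifferentiable 𝓘(ℂ) 𝓘(ℂ) f ∧
  (∀ γ ∈ Gamma0 N, ∀ z : ℍ, f (γ • z) = ν γ * sldenom γ z ^ (k : ℂ) * f z) ∧
  ∀ γ : SL2Z, IsBoundedAtImInfty fun z => sldenom γ z ^ (-(k : ℂ)) * f (γ • z)

/-- Cusp forms of (possibly half-integral) weight `k`, level `Γ₀(N)` and multiplier `ν`. -/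
def IsCuspForm (N : ℕ) (k : ℝ) (ν : SL2Z → ℂ) (f : ℍ → ℂ) : Prop :=
  MDifferentiable 𝓘(ℂ) 𝓘(ℂ) f ∧
  (∀ γ ∈ Gamma0 N, ∀ z : ℍ, f (γ • z) = ν γ * sldenom γ z ^ (k : ℂ) * f z) ∧
  ∀ γ : SL2Z, IsZeroAtImInfty fun z => sldenom γ z ^ (-(k : ℂ)) * f (γ • z)

/-- Weakly holomorphic modular forms: meromorphic at the cusps. -/
def IsWeakModForm (N : ℕ) (k : ℝ) (ν : SL2Z → ℂ) (f : ℍ → ℂ) : Prop :=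
  MDifferentiable 𝓘(ℂ) 𝓘(ℂ) f ∧
  (∀ γ ∈ Gamma0 N, ∀ z : ℍ, f (γ • z) = ν γ * sldenom γ z ^ (k : ℂ) * f z) ∧
  ∀ γ : SL2Z, ∃ m : ℕ, IsBoundedAtImInfty fun z =>
    q24 m z * (sldenom γ z ^ (-(k : ℂ)) * f (γ • z))

/-- `x ∈ K` is `v`-integral: it is a quotient `a/b` with `a, b ∈ 𝓞 K`, `b ∉ v`. -/
def VInt {K : Type*} [Field K] [NumberField K] (v : Ideal (𝓞 K)) (x : K) : Prop :=
  ∃ a b : 𝓞 K, b ∉ v ∧ (b : K) * x = (a : K)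

/-- Congruence modulo `v` in the ring of `v`-integral elements of `K`. -/
def VCong {K : Type*} [Field K] [NumberField K] (v : Ideal (𝓞 K)) (x y : K) : Prop :=
  ∃ a b : 𝓞 K, b ∉ v ∧ a ∈ v ∧ (b : K) * (x - y) = (a : K)

/-- The point `24 z` of the upper half-plane. -/
def smul24 (z : ℍ) : ℍ := ⟨24 * (z : ℂ), by
  have := z.2
  simp only [Complex.mul_im]
  norm_num
  simpa using this⟩

/-- Horizontal translation `z ↦ z + x` on the upper half-plane. -/
def hshift (x : ℝ) (z : ℍ) : ℍ := ⟨(z : ℂ) + (x : ℂ), by simpa using z.2⟩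

/-- `ε_p`: `1` if `p ≡ 1 (mod 4)`, `i` if `p ≡ 3 (mod 4)`. -/
def epsP (p : ℕ) : ℂ := if p % 4 = 1 then 1 else Complex.I

open Filter Topology

lemma dedekindEta_eq_eta (z : ℍ) : dedekindEta z = ModularForm.eta z := by
  simp only [dedekindEta, ModularForm.eta, ModularForm.eta_q_eq_cexp]
  congr 2
  push_cast
  ring

lemma dedekindEta_ne_zero (z : ℍ) : dedekindEta z ≠ 0 := by
  rw [dedekindEta_eq_eta]
  exact ModularForm.eta_ne_zero z.2

lemma dedekindEta_pow_24 (z : ℍ) : dedekindEta z ^ 24 = ModularForm.discriminant z := by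
  rw [dedekindEta_eq_eta, ModularForm.discriminant]

lemma mdifferentiable_dedekindEta_pow (m : ℕ) :
    MDifferentiable 𝓘(ℂ) 𝓘(ℂ) fun z => dedekindEta z ^ m := by
  rw [UpperHalfPlane.mdifferentiable_iff]
  refine .congr (fun z hz ↦ (ModularForm.differentiableAt_eta_of_mem_upperHalfPlaneSet hz).pow
    m |>.differentiableWithinAt) fun z hz ↦ ?_
  simp [dedekindEta_eq_eta, ofComplex_apply_of_im_pos hz]

lemma continuous_dedekindEta : Continuous dedekindEta := by
  simpa using (mdifferentiable_dedekindEta_pow 1).continuous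

lemma sldenom_eq_denom (γ : SL2Z) (z : ℍ) : sldenom γ z = denom γ z := by
  simp [sldenom, denom]

lemma sldenom_ne_zero (γ : SL2Z) (z : ℍ) : sldenom γ z ≠ 0 := by
  rw [sldenom_eq_denom]
  exact denom_ne_zero _ z

lemma dedekindEta_smul_pow_24 (γ : SL2Z) (z : ℍ) :
    dedekindEta (γ • z) ^ 24 = sldenom γ z ^ 12 * dedekindEta z ^ 24 := by
  have h := SlashInvariantForm.slash_action_generators_SL2Z ModularForm.discriminant_S_invariant
    ModularForm.discriminant_T_invariant γ
  have h2 := congrFun h z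
  rw [ModularForm.SL_slash_apply, ← sldenom_eq_denom, _root_.zpow_neg,
    mul_inv_eq_iff_eq_mul₀ (zpow_ne_zero _ (sldenom_ne_zero γ z))] at h2
  rw [dedekindEta_pow_24, dedekindEta_pow_24, h2, mul_comm]
  norm_cast

lemma continuous_sldenom_cpow (γ : SL2Z) (s : ℂ) : Continuous fun z : ℍ => sldenom γ z ^ s := by
  by_cases hc : γ 1 0 = 0
  · simp only [sldenom, hc]
    simpa using continuous_const
  · have hcont : Continuous fun z : ℍ => sldenom γ z := by
      unfold sldenom
      fun_prop
    refine hcont.cpow continuous_const fun z => Or.inr ?_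
    simp [sldenom, hc, z.im_ne_zero]

lemma eq_of_continuous_of_pow_eq_one {X : Type*} [TopologicalSpace X] [PreconnectedSpace X]
    {f : X → ℂ} (hf : Continuous f) {n : ℕ} (hn : n ≠ 0) (h : ∀ x, f x ^ n = 1) (x y : X) :
    f x = f y := by
  by_contra hne
  have hfin : (Set.range f).Finite := by
    have : NeZero n := ⟨hn⟩
    refine (Polynomial.nthRootsFinset n (1 : ℂ)).finite_toSet.subset ?_
    rintro _ ⟨x, rfl⟩
    simpa [Polynomial.mem_nthRootsFinset (Nat.pos_of_ne_zero hn)] using h x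
  exact (isPreconnected_range hf).infinite_of_nontrivial
    ⟨f x, ⟨x, rfl⟩, f y, ⟨y, rfl⟩, hne⟩ hfin

lemma cpow_half_pow_24 (w : ℂ) : (w ^ ((1 : ℂ) / 2)) ^ 24 = w ^ 12 := by
  rw [← Complex.cpow_nat_mul]
  norm_num

/-- The transformation law of the eta function under the full modular group. -/
lemma dedekindEta_smul (γ : SL2Z) (z : ℍ) :
    dedekindEta (γ • z) = nuEta γ * sldenom γ z ^ ((1 : ℂ) / 2) * dedekindEta z := by
  have h0 (w : ℍ) : sldenom γ w ^ ((1 : ℂ) / 2) * dedekindEta w ≠ 0 :=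
    mul_ne_zero (by simp [sldenom_ne_zero]) (dedekindEta_ne_zero w)
  have hcont : Continuous fun w : ℍ =>
      dedekindEta (γ • w) / (sldenom γ w ^ ((1 : ℂ) / 2) * dedekindEta w) :=
    (continuous_dedekindEta.comp (continuous_const_smul (γ : GL (Fin 2) ℝ))).div
      ((continuous_sldenom_cpow γ _).mul continuous_dedekindEta) h0
  have key := eq_of_continuous_of_pow_eq_one hcont (n := 24) (by norm_num) (fun w => by
    rw [div_pow, mul_pow, cpow_half_pow_24, dedekindEta_smul_pow_24]
    exact div_self (mul_ne_zero (pow_ne_zero _ (sldenom_ne_zero _ _))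
      (pow_ne_zero _ (dedekindEta_ne_zero _)))) z UpperHalfPlane.I
  rw [nuEta, ← key, mul_assoc, div_mul_cancel₀ _ (h0 z)]

lemma isZeroAtImInfty_dedekindEta_pow {m : ℕ} (hm : m ≠ 0) :
    IsZeroAtImInfty fun z => dedekindEta z ^ m := by
  have h : Tendsto (fun z => ‖dedekindEta z‖ ^ 24) atImInfty (𝓝 0) := by
    have h1 := ModularForm.discriminant_isZeroAtImInfty.norm
    simpa [← dedekindEta_pow_24] using h1
  have h2 : Tendsto (fun z => ‖dedekindEta z‖) atImInfty (𝓝 0) := by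
    have h3 := h.rpow_const (p := (1 / 24 : ℝ)) (Or.inr (by norm_num))
    rw [Real.zero_rpow (by norm_num)] at h3
    refine h3.congr fun z => ?_
    have := Real.pow_rpow_inv_natCast (norm_nonneg (dedekindEta z)) (n := 24) (by norm_num)
    rw [one_div]
    exact_mod_cast this
  have h4 := (tendsto_zero_iff_norm_tendsto_zero.2 h2).pow m
  rwa [zero_pow hm] at h4

lemma isCuspForm_dedekindEta_pow {m : ℕ} (hm : m ≠ 0) {k : ℝ} (hk : k = m / 2) :
    IsCuspForm 1 k (fun γ => nuEta γ ^ m) (fun z => dedekindEta z ^ m) := by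
  have htrans (γ : SL2Z) (z : ℍ) :
      dedekindEta (γ • z) ^ m = nuEta γ ^ m * sldenom γ z ^ (k : ℂ) * dedekindEta z ^ m := by
    rw [dedekindEta_smul, mul_pow, mul_pow, ← Complex.cpow_nat_mul, hk]
    congr 3
    push_cast
    ring
  refine ⟨mdifferentiable_dedekindEta_pow m, fun γ _ => htrans γ, fun γ => ?_⟩
  have h := (isZeroAtImInfty_dedekindEta_pow hm).const_mul (nuEta γ ^ m)
  rw [mul_zero] at h
  refine h.congr fun z => ?_
  have h0 : sldenom γ z ^ (k : ℂ) ≠ 0 := by simp [sldenom_ne_zero]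
  simp only [htrans, Complex.cpow_neg]
  field_simp

lemma summable_norm_coeff_pow {f : PowerSeries ℤ} {x : ℂ}
    (hf : Summable fun n => ‖((f.coeff n : ℤ) : ℂ) * x ^ n‖) (m : ℕ) :
    (Summable fun n => ‖(((f ^ m).coeff n : ℤ) : ℂ) * x ^ n‖) ∧
      ∑' n, (((f ^ m).coeff n : ℤ) : ℂ) * x ^ n = (∑' n, ((f.coeff n : ℤ) : ℂ) * x ^ n) ^ m := by
  induction m with
  | zero =>
    have h (n : ℕ) (hn : n ≠ 0) : (((f ^ 0).coeff n : ℤ) : ℂ) * x ^ n = 0 := by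
      simp [PowerSeries.coeff_one, hn]
    refine ⟨summable_of_ne_finset_zero (s := {0}) fun n hn => ?_, ?_⟩
    · rw [h n (by simpa using hn), norm_zero]
    · rw [tsum_eq_single 0 h]
      simp
  | succ m ih =>
    have hcoeff (n : ℕ) : (((f ^ (m + 1)).coeff n : ℤ) : ℂ) * x ^ n =
        ∑ kl ∈ Finset.HasAntidiagonal.antidiagonal n, ((((f ^ m).coeff kl.1 : ℤ) : ℂ) * x ^ kl.1) *
          (((f.coeff kl.2 : ℤ) : ℂ) * x ^ kl.2) := by
      rw [pow_succ, PowerSeries.coeff_mul, Int.cast_sum, Finset.sum_mul]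
      refine Finset.sum_congr rfl fun kl hkl => ?_
      have h : kl.1 + kl.2 = n := Finset.HasAntidiagonal.mem_antidiagonal.1 hkl
      have hx : x ^ n = x ^ kl.1 * x ^ kl.2 := by rw [← pow_add, h]
      rw [hx, Int.cast_mul, mul_mul_mul_comm]
    have hsum := summable_norm_sum_mul_antidiagonal_of_summable_norm ih.1 hf
    have htsum := tsum_mul_tsum_eq_tsum_sum_antidiagonal_of_summable_norm ih.1 hf
    rw [ih.2, ← pow_succ] at htsum
    exact ⟨hsum.congr fun n => congrArg norm (hcoeff n).symm,
      (tsum_congr hcoeff).trans htsum.symm⟩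

lemma norm_coeff_pentagonalSeries_le (n : ℕ) :
    ‖(((PowerSeries.pentagonalSeries ℤ).coeff n : ℤ) : ℂ)‖ ≤ 1 := by
  by_cases h : n ∈ Set.range pentagonal
  · obtain ⟨k, rfl⟩ := h
    rw [PowerSeries.coeff_pentagonalSeries_pentagonal]
    rcases Int.even_or_odd k with hk | hk
    · simp [Int.negOnePow_even _ hk]
    · simp [Int.negOnePow_odd _ hk]
  · simp [PowerSeries.coeff_pentagonalSeries_eq_zero ℤ h]

lemma summable_norm_coeff_pentagonalSeries {x : ℂ} (hx : ‖x‖ < 1) :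
    Summable fun n => ‖(((PowerSeries.pentagonalSeries ℤ).coeff n : ℤ) : ℂ) * x ^ n‖ := by
  refine (summable_geometric_of_lt_one (norm_nonneg x) hx).of_nonneg_of_le
    (fun n => norm_nonneg _) fun n => ?_
  rw [norm_mul, norm_pow]
  exact mul_le_of_le_one_left (by positivity) (norm_coeff_pentagonalSeries_le n)

lemma hasSum_pentagonal {x : ℂ} (hx : ‖x‖ < 1) :
    HasSum (fun k : ℕ => (-1) ^ k * (x ^ pentagonal (-k) - x ^ pentagonal (k + 1)))
      (∑' n, (((PowerSeries.pentagonalSeries ℤ).coeff n : ℤ) : ℂ) * x ^ n) := by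
  have h : HasSum ((fun n => (((PowerSeries.pentagonalSeries ℤ).coeff n : ℤ) : ℂ) * x ^ n) ∘
      pentagonal) (∑' n, (((PowerSeries.pentagonalSeries ℤ).coeff n : ℤ) : ℂ) * x ^ n) := by
    rw [pentagonal_injective.hasSum_iff fun n hn ↦ by
      simp [PowerSeries.coeff_pentagonalSeries_eq_zero ℤ hn]]
    exact (summable_norm_coeff_pentagonalSeries hx).of_norm.hasSum
  rw [← neg_injective.hasSum_iff (fun x hx ↦ by absurd hx; use -x; simp)] at h
  convert h.nat_add_neg_add_one using 2 with k
  simp_rw [Function.comp_apply, neg_neg, PowerSeries.coeff_pentagonalSeries_pentagonal,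
    Int.negOnePow_add]
  simp
  ring

lemma norm_prod_one_sub_pow_le {x : ℂ} (hx : ‖x‖ < 1) (k n : ℕ) :
    ‖∏ i ∈ Finset.range n, (1 - x ^ (k + i + 1))‖ ≤ Real.exp (1 - ‖x‖)⁻¹ := by
  calc ‖∏ i ∈ Finset.range n, (1 - x ^ (k + i + 1))‖
      ≤ ∏ i ∈ Finset.range n, Real.exp (‖x‖ ^ i) := by
        rw [norm_prod]
        refine Finset.prod_le_prod (fun i _ => norm_nonneg _) fun i _ => ?_
        calc ‖1 - x ^ (k + i + 1)‖ ≤ ‖(1 : ℂ)‖ + ‖x ^ (k + i + 1)‖ := norm_sub_le _ _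
          _ ≤ ‖x‖ ^ i + 1 := by
            rw [norm_one, norm_pow, add_comm]
            gcongr ?_ + 1
            exact pow_le_pow_of_le_one (norm_nonneg x) hx.le (by omega)
          _ ≤ Real.exp (‖x‖ ^ i) := Real.add_one_le_exp _
    _ = Real.exp (∑ i ∈ Finset.range n, ‖x‖ ^ i) := (Real.exp_sum _ _).symm
    _ ≤ Real.exp (1 - ‖x‖)⁻¹ := by
        gcongr
        rw [← tsum_geometric_of_lt_one (norm_nonneg x) hx]
        exact (summable_geometric_of_lt_one (norm_nonneg x) hx).sum_le_tsum _
          fun i _ => by positivity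

/-- Euler's pentagonal number theorem on the open unit disc. -/
lemma tprod_one_sub_pow_eq_tsum {x : ℂ} (hx : ‖x‖ < 1) :
    ∏' n : ℕ, (1 - x ^ (n + 1)) =
      ∑' n, (((PowerSeries.pentagonalSeries ℤ).coeff n : ℤ) : ℂ) * x ^ n := by
  have hgeom := summable_geometric_of_lt_one (norm_nonneg x) hx
  have hbound (k n : ℕ) :
      ‖x ^ ((k + 1) * n) * ∏ i ∈ Finset.range (n + 1), (1 - x ^ (k + i + 1))‖ ≤
        ‖x‖ ^ n * Real.exp (1 - ‖x‖)⁻¹ := by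
    rw [norm_mul, norm_pow]
    refine mul_le_mul (pow_le_pow_of_le_one (norm_nonneg x) hx.le ?_)
      (norm_prod_one_sub_pow_le hx k _) (norm_nonneg _) (by positivity)
    exact Nat.le_mul_of_pos_left n k.succ_pos
  have hsum := hasSum_pentagonal hx
  rw [← hsum.tsum_eq]
  refine Pentagonal.tprod_one_sub_pow (tendsto_pow_atTop_nhds_zero_of_norm_lt_one hx)
    (fun k => (hgeom.mul_right _).of_norm_bounded (hbound k)) (fun k => ?_) hsum.summable ?_
  · simp_rw [sub_eq_add_neg]
    refine multipliable_one_add_of_summable ?_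
    simpa [add_assoc] using (summable_nat_add_iff (k + 1)).mpr hgeom
  · have hzero := (tendsto_pow_atTop_nhds_zero_of_lt_one (norm_nonneg x) hx).mul_const
      (∑' n : ℕ, ‖x‖ ^ n * Real.exp (1 - ‖x‖)⁻¹)
    rw [zero_mul] at hzero
    refine squeeze_zero_norm (fun k => ?_) hzero
    rw [norm_mul, norm_mul, norm_pow, norm_pow, norm_neg, norm_one, one_pow, one_mul]
    refine mul_le_mul (pow_le_pow_of_le_one (norm_nonneg x) hx.le ?_)
      (tsum_of_norm_bounded (hgeom.mul_right _).hasSum (hbound k)) (norm_nonneg _) (by positivity)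
    rw [Nat.le_div_iff_mul_le two_pos]
    nlinarith

/-- The coefficient of `q^{N/24}` in `η^m`. -/
def etaPowCoeff (m : ℕ) : ℕ → ℤ :=
  Function.extend (fun n => m + 24 * n)
    (fun n => ((PowerSeries.pentagonalSeries ℤ) ^ m).coeff n) 0

lemma injective_add_24_mul (m : ℕ) : Function.Injective fun n => m + 24 * n :=
  fun a b h => by simpa using h

lemma dedekindEta_pow_eq_tsum (m : ℕ) (z : ℍ) :
    dedekindEta z ^ m = ∑' n : ℕ, ((etaPowCoeff m n : ℤ) : ℂ) * q24 n z := by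
  set x : ℂ := Complex.exp (2 * Real.pi * Complex.I * z) with hx
  have hx1 : ‖x‖ < 1 := norm_exp_two_pi_I_lt_one z
  have hprod : ∏' n : ℕ, (1 - Complex.exp (2 * Real.pi * Complex.I * ((n : ℂ) + 1) * (z : ℂ))) =
      ∏' n : ℕ, (1 - x ^ (n + 1)) := by
    congr! 3 with n
    rw [hx, ← Complex.exp_nat_mul]
    congr 1
    push_cast
    ring
  rw [← (injective_add_24_mul m).tsum_eq, dedekindEta, hprod, tprod_one_sub_pow_eq_tsum hx1, mul_pow,
    ← (summable_norm_coeff_pow (summable_norm_coeff_pentagonalSeries hx1) m).2, ← tsum_mul_left]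
  · refine tsum_congr fun n => ?_
    rw [etaPowCoeff, (injective_add_24_mul m).extend_apply, mul_left_comm]
    congr 1
    rw [hx, q24, ← Complex.exp_nat_mul, ← Complex.exp_nat_mul, ← Complex.exp_add]
    congr 1
    push_cast
    ring
  · intro n hn
    by_contra hne
    refine hn ?_
    simp [etaPowCoeff, Function.extend_apply' _ _ _ hne]

lemma kron12_eq_zero {s : ℤ} (h : s % 2 = 0 ∨ s % 3 = 0) : kron12 s = 0 := by
  unfold kron12
  split_ifs <;> omega

lemma kron12_six_mul_add_one (j : ℤ) : kron12 (6 * j + 1) = Int.negOnePow j := by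
  rcases Int.even_or_odd' j with ⟨c, rfl | rfl⟩
  · rw [Int.negOnePow_even _ (even_two_mul c), kron12, if_pos (by omega), Units.val_one]
  · rw [Int.negOnePow_odd _ (odd_two_mul_add_one c), kron12, if_neg (by omega), if_pos (by omega)]
    rfl

lemma kron12_neg (s : ℤ) : kron12 (-s) = kron12 s := by
  unfold kron12
  split_ifs <;> omega

/-- If `1 + 24 g = s²`, then `g` is a pentagonal number, and `(12/s)` is the corresponding
coefficient of the pentagonal number series. -/
lemma coeff_pentagonalSeries_eq_kron12 {g s : ℕ} (h : s ^ 2 = 1 + 24 * g) :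
    (PowerSeries.pentagonalSeries ℤ).coeff g = kron12 s := by
  obtain ⟨j, hj⟩ : ∃ j : ℤ, (s : ℤ) = 6 * j + 1 ∨ (s : ℤ) = -(6 * j + 1) := by
    have h6 : s ^ 2 % 6 = 1 := by omega
    rw [Nat.pow_mod] at h6
    have hs : s % 6 = 1 ∨ s % 6 = 5 := by
      have : s % 6 < 6 := Nat.mod_lt _ (by norm_num)
      interval_cases s % 6 <;> simp_all
    rcases hs with hs | hs
    · exact ⟨s / 6, by omega⟩
    · exact ⟨-(s / 6) - 1, by omega⟩
  have hg : pentagonal (-j) = g := by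
    have h1 := two_mul_natCast_pentagonal_neg j
    have h2 : (s : ℤ) ^ 2 = (6 * j + 1) ^ 2 := by rcases hj with hj | hj <;> rw [hj]; ring
    zify at h ⊢
    have h3 : (24 : ℤ) * pentagonal (-j) = 24 * g := by linear_combination 12 * h1 + h - h2
    omega
  have hk : kron12 s = kron12 (6 * j + 1) := by
    rcases hj with hj | hj <;> rw [hj]
    exact kron12_neg _
  rw [← hg, PowerSeries.coeff_pentagonalSeries_pentagonal, hk, kron12_six_mul_add_one,
    Int.negOnePow_neg]
  rfl

lemma coeff_pentagonalSeries_eq_zero_of_forall_sq_ne {g : ℕ} (h : ∀ s : ℕ, s ^ 2 ≠ 1 + 24 * g) :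
    (PowerSeries.pentagonalSeries ℤ).coeff g = 0 := by
  refine PowerSeries.coeff_pentagonalSeries_eq_zero ℤ ?_
  rintro ⟨k, rfl⟩
  refine h (6 * k - 1).natAbs ?_
  zify
  rw [sq_abs]
  linear_combination (-12) * two_mul_natCast_pentagonal k

lemma coeff_pentagonalSeries_eq_ite (g : ℕ) :
    (PowerSeries.pentagonalSeries ℤ).coeff g =
      if (1 + 24 * g).sqrt ^ 2 = 1 + 24 * g then kron12 (1 + 24 * g).sqrt else 0 := by
  split_ifs with h
  · exact coeff_pentagonalSeries_eq_kron12 h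
  · refine coeff_pentagonalSeries_eq_zero_of_forall_sq_ne fun s hs => h ?_
    rw [← hs, Nat.sqrt_eq']

lemma coeff_pow_prime_sq_modEq (f : PowerSeries ℤ) {p : ℕ} (hp : p.Prime) (n : ℕ) :
    (f ^ p ^ 2).coeff n ≡ (if p ^ 2 ∣ n then f.coeff (n / p ^ 2) else 0) [ZMOD (p : ℤ)] := by
  have : Fact p.Prime := ⟨hp⟩
  have hpow : PowerSeries.expand (p ^ 2) (pow_ne_zero 2 hp.ne_zero)
      (f.map (Int.castRingHom (ZMod p))) = (f.map (Int.castRingHom (ZMod p))) ^ p ^ 2 := by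
    have h := MvPowerSeries.map_iterateFrobenius_expand p hp.ne_zero
      (f.map (Int.castRingHom (ZMod p))) 2
    have hid : iterateFrobenius (ZMod p) p 2 = RingHom.id _ := RingHom.ext_zmod _ _
    rw [hid, MvPowerSeries.map_id] at h
    exact h
  rw [← ZMod.intCast_eq_intCast_iff]
  have h := congrArg (PowerSeries.coeff n) hpow
  rw [← map_pow, PowerSeries.coeff_map, PowerSeries.coeff_expand, PowerSeries.coeff_map] at h
  simp only [eq_intCast] at h
  rw [← h]
  split_ifs <;> simp

lemma sq_mod_24 {s : ℕ} (h2 : s % 2 ≠ 0) (h3 : s % 3 ≠ 0) : s ^ 2 % 24 = 1 := by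
  rw [Nat.pow_mod]
  have h : s % 24 < 24 := Nat.mod_lt _ (by norm_num)
  have h2' : s % 24 % 2 ≠ 0 := by omega
  have h3' : s % 24 % 3 ≠ 0 := by omega
  interval_cases s % 24 <;> simp_all

lemma etaPowCoeff_prime_sq_modEq {p : ℕ} (hp : p.Prime) (hp5 : 5 ≤ p) (n : ℕ) :
    etaPowCoeff (p ^ 2) n ≡ (if p ^ 2 ∣ n ∧ (n / p ^ 2).sqrt ^ 2 = n / p ^ 2 ∧ 1 ≤ n
      then kron12 (((n / p ^ 2).sqrt : ℤ)) else 0) [ZMOD (p : ℤ)] := by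
  have hp2 : p % 2 ≠ 0 := fun h =>
    absurd ((Nat.prime_dvd_prime_iff_eq Nat.prime_two hp).1 (Nat.dvd_of_mod_eq_zero h)) (by omega)
  have hp3 : p % 3 ≠ 0 := fun h =>
    absurd ((Nat.prime_dvd_prime_iff_eq Nat.prime_three hp).1 (Nat.dvd_of_mod_eq_zero h)) (by omega)
  have hp24 := sq_mod_24 hp2 hp3
  have hpos : 0 < p ^ 2 := pow_pos hp.pos 2
  by_cases hn : ∃ a, p ^ 2 + 24 * a = n
  · obtain ⟨a, rfl⟩ := hn
    have hcop : Nat.Coprime (p ^ 2) 24 := by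
      rw [Nat.coprime_iff_gcd_eq_one, Nat.gcd_comm, Nat.gcd_rec, hp24]
      simp
    have hdvd : p ^ 2 ∣ p ^ 2 + 24 * a ↔ p ^ 2 ∣ a := by
      rw [Nat.dvd_add_right (dvd_refl _), hcop.dvd_mul_left]
    rw [etaPowCoeff, (injective_add_24_mul (p ^ 2)).extend_apply]
    refine (coeff_pow_prime_sq_modEq _ hp a).trans ?_
    by_cases ha : p ^ 2 ∣ a
    · obtain ⟨g, rfl⟩ := ha
      have hdiv : (p ^ 2 + 24 * (p ^ 2 * g)) / p ^ 2 = 1 + 24 * g := by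
        rw [show p ^ 2 + 24 * (p ^ 2 * g) = p ^ 2 * (1 + 24 * g) by ring,
          Nat.mul_div_cancel_left _ hpos]
      have hone : 1 ≤ p ^ 2 + 24 * (p ^ 2 * g) := by omega
      simp only [hdvd, hdiv, hone, dvd_mul_right, if_true, true_and, and_true,
        Nat.mul_div_cancel_left _ hpos, coeff_pentagonalSeries_eq_ite]
      rfl
    · simp only [hdvd, ha, if_false, false_and]
      rfl
  · rw [etaPowCoeff, Function.extend_apply' _ _ _ hn]
    split_ifs with h
    · obtain ⟨⟨c, rfl⟩, hs, hc⟩ := h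
      rw [Nat.mul_div_cancel_left _ hpos] at hs ⊢
      by_cases hmod : c.sqrt % 2 ≠ 0 ∧ c.sqrt % 3 ≠ 0
      · have hc24 := sq_mod_24 hmod.1 hmod.2
        rw [hs] at hc24
        refine absurd ⟨p ^ 2 * (c / 24), ?_⟩ hn
        have hc' : c = 1 + 24 * (c / 24) := by omega
        calc p ^ 2 + 24 * (p ^ 2 * (c / 24)) = p ^ 2 * (1 + 24 * (c / 24)) := by ring
          _ = p ^ 2 * c := by rw [← hc']
      · rw [kron12_eq_zero (by omega)]
        rfl
    · rfl

/-- `η^{ℓ²} ∈ S_{ℓ²/2}(1, ν_η^{ℓ²})` and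
`η^{ℓ²} ≡ Σ_{n≥1} (12/n) q^{ℓ²n²/24} (mod ℓ)`. -/
theorem stmt19 (ℓ : ℕ) (hℓ : ℓ.Prime) (hℓ5 : 5 ≤ ℓ) :
    IsCuspForm 1 ((ℓ : ℝ) ^ 2 / 2) (fun γ => nuEta γ ^ (ℓ ^ 2))
      (fun z => dedekindEta z ^ (ℓ ^ 2)) ∧
    ∃ b : ℕ → ℤ,
      (∀ z : ℍ, dedekindEta z ^ (ℓ ^ 2) = ∑' n : ℕ, ((b n : ℤ) : ℂ) * q24 n z) ∧
      ∀ n : ℕ,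
        b n ≡ (if ℓ ^ 2 ∣ n ∧ (n / ℓ ^ 2).sqrt ^ 2 = n / ℓ ^ 2 ∧ 1 ≤ n
          then kron12 (((n / ℓ ^ 2).sqrt : ℤ)) else 0) [ZMOD (ℓ : ℤ)] :=
  ⟨isCuspForm_dedekindEta_pow (pow_ne_zero 2 hℓ.ne_zero) (by push_cast; rfl),
    etaPowCoeff (ℓ ^ 2), dedekindEta_pow_eq_tsum (ℓ ^ 2), etaPowCoeff_prime_sq_modEq hℓ hℓ5⟩
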